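/- For every sliced coloring C of ℤ^d, d ≤ s^R(C) · (2·s^B(C) − 1). -/

import Mathlib

open Function

section Lattice

variable {ι : Type*} [Fintype ι] [DecidableEq ι]

/-- A two-coloring of the lattice `ℤ^ι`: `false` = red, `true` = blue. -/
def sensAt (C : (ι → ℤ) → Bool) (x : ι → ℤ) : ℕ :=
  (Finset.univ.filter fun p : ι × Bool =>
    C (Function.update x p.1 (x p.1 + if p.2 then 1 else -1)) ≠ C x).card

/-- The axis-sensitivity of `C` at the point `x`: the number of coordinate
directions along which some neighbor of `x` has a different color. -/
def axisSensAt (C : (ι → ℤ) → Bool) (x : ι → ℤ) : ℕ :=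
  (Finset.univ.filter fun i : ι =>
    C (Function.update x i (x i + 1)) ≠ C x ∨
      C (Function.update x i (x i - 1)) ≠ C x).card

/-- The sensitivity `s(C)` of a coloring: the maximum of `s(C,x)` over all `x`. -/
noncomputable def sensSup (C : (ι → ℤ) → Bool) : ℕ := sSup (Set.range (sensAt C))

/-- The axis-sensitivity `r(C)` of a coloring: the maximum of `r(C,x)` over all `x`. -/
noncomputable def axisSensSup (C : (ι → ℤ) → Bool) : ℕ := sSup (Set.range (axisSensAt C))

/-- The red sensitivity `s^R(C)`: maximum axis-sensitivity over red points. -/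
noncomputable def redSens (C : (ι → ℤ) → Bool) : ℕ := sSup (axisSensAt C '' {x | C x = false})

/-- The blue sensitivity `s^B(C)`: maximum axis-sensitivity over blue points. -/
noncomputable def blueSens (C : (ι → ℤ) → Bool) : ℕ := sSup (axisSensAt C '' {x | C x = true})

/-- A coloring is non-trivial if the origin is red and each axis carries a blue point. -/
def NontrivialColoring (C : (ι → ℤ) → Bool) : Prop :=
  C (fun _ => 0) = false ∧
    ∀ i : ι, ∃ m : ℤ, C (Function.update (fun _ => 0) i m) = true

/-- `y` is a neighbor of `x`: they differ by `±1` in exactly one coordinate. -/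
def IsNeighbor (x y : ι → ℤ) : Prop :=
  ∃ i : ι, y = Function.update x i (x i + 1) ∨ y = Function.update x i (x i - 1)

/-- `k` is the min-width of `C`: the least positive integer such that on every axis
there is a blue point within distance `k` of the origin. -/
def MinWidth (C : (ι → ℤ) → Bool) (k : ℕ) : Prop :=
  IsLeast {w : ℕ | 0 < w ∧ ∀ i : ι, ∃ m : ℤ, |m| ≤ (w : ℤ) ∧
    C (Function.update (fun _ => 0) i m) = true} k

end Lattice

section Sliced

/-- The slice of `ℤ^d` with nonzero coordinate `y` fixed to the constant `c`
and the coordinates in `X` fixed to `0`. -/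
def sliceSet (d : ℕ) (y : Fin d) (c : ℤ) (X : Set (Fin d)) : Set (Fin d → ℤ) :=
  {x | x y = c ∧ ∀ i ∈ X, x i = 0}

/-- `C` is a sliced coloring with nonzero constants `c i ≥ 3` and zero sets `X i`:
it is non-trivial and its blue points are exactly the union of the `d` slices
`S_i = sliceSet d i (c i) (X i)`, where `S_i` has its nonzero coordinate in dimension `i`. -/
def IsSlicedColoring (d : ℕ) (C : (Fin d → ℤ) → Bool) (c : Fin d → ℤ)
    (X : Fin d → Set (Fin d)) : Prop :=
  NontrivialColoring C ∧ (∀ i, 3 ≤ c i) ∧ (∀ i, i ∉ X i) ∧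
    ∀ x, C x = true ↔ ∃ i : Fin d, x ∈ sliceSet d i (c i) (X i)

end Sliced

/-- If every vertex has at most `k` out-neighbors under `r`, then every finite set `S` contains an
`r`-independent subset of size at least `|S| / (2k + 1)`. -/
theorem exists_independent_subset {α : Type*} [DecidableEq α] (r : α → α → Prop) [DecidableRel r]
    (hr : ∀ a, ¬ r a a) (k : ℕ) (S : Finset α) (hk : ∀ a ∈ S, (S.filter (r a)).card ≤ k) :
    ∃ I ⊆ S, (∀ a ∈ I, ∀ b ∈ I, ¬ r a b) ∧ S.card ≤ I.card * (2 * k + 1) := by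
  induction S using Finset.strongInduction with
  | H S ih =>
    rcases S.eq_empty_or_nonempty with rfl | hS
    · exact ⟨∅, by simp⟩
    obtain ⟨v, hv, hvk⟩ : ∃ v ∈ S, (S.filter fun a => r a v).card ≤ k := by
      apply Finset.exists_le_of_sum_le hS
      have := Finset.sum_card_bipartiteAbove_eq_sum_card_bipartiteBelow (s := S) (t := S) r
      simp only [Finset.bipartiteAbove, Finset.bipartiteBelow] at this
      rw [← this]
      exact Finset.sum_le_sum hk
    set N : Finset α := insert v (S.filter (r v) ∪ S.filter fun a => r a v) with hN
    have hNS : N ⊆ S := by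
      intro a ha
      simp only [hN, Finset.mem_insert, Finset.mem_union, Finset.mem_filter] at ha
      rcases ha with rfl | ha | ha
      exacts [hv, ha.1, ha.1]
    have hvN : v ∈ N := Finset.mem_insert_self _ _
    have hNk : N.card ≤ 2 * k + 1 := by
      have h₁ := Finset.card_insert_le v (S.filter (r v) ∪ S.filter fun a => r a v)
      have h₂ := Finset.card_union_le (S.filter (r v)) (S.filter fun a => r a v)
      have h₃ := hk v hv
      rw [hN]
      omega
    obtain ⟨I, hIS, hI, hcard⟩ := ih (S \ N) (Finset.sdiff_ssubset hNS ⟨v, hvN⟩) fun a ha =>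
      (Finset.card_le_card (Finset.filter_subset_filter _ Finset.sdiff_subset)).trans
        (hk a (Finset.sdiff_subset ha))
    have hout : ∀ a ∈ I, a ≠ v ∧ ¬ r v a ∧ ¬ r a v := by
      intro a ha
      have := hIS ha
      simp only [hN, Finset.mem_sdiff, Finset.mem_insert, Finset.mem_union,
        Finset.mem_filter] at this
      tauto
    refine ⟨insert v I, ?_, ?_, ?_⟩
    · exact Finset.insert_subset hv (hIS.trans Finset.sdiff_subset)
    · intro a ha b hb
      rcases Finset.mem_insert.1 ha with hav | ha' <;> rcases Finset.mem_insert.1 hb with hbv | hb'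
      · exact hav ▸ hbv ▸ hr v
      · exact hav ▸ (hout b hb').2.1
      · exact hbv ▸ (hout a ha').2.2
      · exact hI a ha' b hb'
    · rw [Finset.card_insert_of_notMem fun h => (hout v h).1 rfl, add_mul, one_mul]
      have := Finset.card_sdiff_add_card_eq_card hNS
      omega

section Sensitivity

variable {ι : Type*} [Fintype ι] [DecidableEq ι]

theorem axisSensAt_le_card (C : (ι → ℤ) → Bool) (x : ι → ℤ) :
    axisSensAt C x ≤ Fintype.card ι :=
  Finset.card_le_univ _

theorem axisSensAt_le_redSens {C : (ι → ℤ) → Bool} {x : ι → ℤ} (hx : C x = false) :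
    axisSensAt C x ≤ redSens C :=
  le_csSup ⟨Fintype.card ι, by rintro _ ⟨y, -, rfl⟩; exact axisSensAt_le_card C y⟩ ⟨x, hx, rfl⟩

theorem axisSensAt_le_blueSens {C : (ι → ℤ) → Bool} {x : ι → ℤ} (hx : C x = true) :
    axisSensAt C x ≤ blueSens C :=
  le_csSup ⟨Fintype.card ι, by rintro _ ⟨y, -, rfl⟩; exact axisSensAt_le_card C y⟩ ⟨x, hx, rfl⟩

end Sensitivity

namespace IsSlicedColoring

variable {d : ℕ} {C : (Fin d → ℤ) → Bool} {c : Fin d → ℤ} {X : Fin d → Set (Fin d)}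

open Classical in
/-- The slice with `m` zero coordinates forces blue sensitivity at least `m + 1`. -/
theorem card_zeros_lt_blueSens (h : IsSlicedColoring d C c X) (i : Fin d) :
    (Finset.univ.filter (· ∈ X i)).card < blueSens C := by
  obtain ⟨-, hc, hX, hC⟩ := h
  let x : Fin d → ℤ := fun j => if j = i then c i else if j ∈ X i then 0 else -5
  have hxi : x i = c i := by simp [x]
  have hx0 : ∀ j ∈ X i, x j = 0 := by
    intro j hj
    have : j ≠ i := by rintro rfl; exact hX _ hj
    simp [x, this, hj]
  have hx1 : ∀ j, j ≠ i → x j ≤ 0 := by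
    intro j hj
    simp only [x, hj, if_false]
    split_ifs <;> norm_num
  have hblue : C x = true := (hC x).2 ⟨i, hxi, hx0⟩
  refine lt_of_lt_of_le ?_ (axisSensAt_le_blueSens hblue)
  have hi : i ∉ Finset.univ.filter (· ∈ X i) := by simpa using hX i
  rw [Nat.lt_iff_add_one_le, ← Finset.card_insert_of_notMem hi]
  refine Finset.card_le_card fun j hj => ?_
  simp only [Finset.mem_insert, Finset.mem_filter, Finset.mem_univ, true_and] at hj ⊢
  left
  rw [hblue]
  intro hb
  obtain ⟨l, hl, hl0⟩ := (hC _).1 hb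
  have hli : l = i := by
    by_contra hne
    have h₁ := hx1 l hne
    have h₂ := hc l
    rcases eq_or_ne l j with rfl | hlj
    · rw [Function.update_self] at hl
      omega
    · rw [Function.update_of_ne hlj] at hl
      omega
  subst hli
  rcases hj with rfl | hj
  · rw [Function.update_self] at hl
    omega
  · have h₁ := hl0 j hj
    rw [Function.update_self, hx0 j hj] at h₁
    omega

/-- A set of dimensions none of which is a zero coordinate of another one's slice gives a red point
that is sensitive in all of these dimensions. -/
theorem card_le_redSens (h : IsSlicedColoring d C c X) (I : Finset (Fin d))
    (hI : ∀ i ∈ I, ∀ j ∈ I, j ∉ X i) : I.card ≤ redSens C := by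
  obtain ⟨-, hc, hX, hC⟩ := h
  let x : Fin d → ℤ := fun j => if j ∈ I then c j - 1 else 0
  have hred : C x = false := by
    rw [← Bool.not_eq_true, hC]
    rintro ⟨i, hi, -⟩
    have := hc i
    simp only [x] at hi
    split_ifs at hi <;> omega
  refine le_trans (Finset.card_le_card fun i hi => ?_) (axisSensAt_le_redSens hred)
  simp only [Finset.mem_filter, Finset.mem_univ, true_and]
  left
  rw [hred, ne_eq, Bool.not_eq_false, hC]
  refine ⟨i, by simp [x, hi], fun j hj => ?_⟩
  have hji : j ≠ i := by rintro rfl; exact hX _ hj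
  have hjI : j ∉ I := fun hjI => hI i hi j hjI hj
  simp [x, hji, hjI]

end IsSlicedColoring

/-- For every sliced coloring `C` of `ℤ^d`,
`d ≤ s^R(C)·(2·s^B(C) - 1)`. -/
theorem sliced_dimension_bound (d : ℕ) (C : (Fin d → ℤ) → Bool)
    (c : Fin d → ℤ) (X : Fin d → Set (Fin d)) (h : IsSlicedColoring d C c X) :
    d ≤ redSens C * (2 * blueSens C - 1) := by
  classical
  rcases Nat.eq_zero_or_pos d with rfl | hd
  · exact Nat.zero_le _
  have hb := h.card_zeros_lt_blueSens
  have hb0 := hb ⟨0, hd⟩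
  obtain ⟨I, -, hI, hcard⟩ := exists_independent_subset (fun i j => j ∈ X i) h.2.2.1
    (blueSens C - 1) Finset.univ fun i _ => Nat.le_sub_one_of_lt (by convert hb i)
  rw [Finset.card_univ, Fintype.card_fin] at hcard
  have hk : 2 * (blueSens C - 1) + 1 = 2 * blueSens C - 1 := by omega
  rw [hk] at hcard
  exact hcard.trans (Nat.mul_le_mul_right _ (h.card_le_redSens I hI))
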